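/- arXiv:1608.00634 — 5 statements merged into one kernel-verified Lean document; each statement's English description precedes it below -/
import Mathlib

section
/- Let K > 0, λ_e > 0, c₀ > 0, β ≥ 2, and let G : ℝ → ℝ be continuous. Let μ be the real Gaussian measure with mean 0 and variance 1/2, define A(x,y) = (1/2)·c₀^{2/β}·∫₀^{2π} ((K·G(θ)² + x² + y² + 2·√K·G(θ)·x)/(K+1))^{2/β} dθ and p̄ = 1 − ∫∫ exp(−λ_e·A(x,y)) dμ(x) dμ(y), and set A₀ = ∫₀^{2π} G(θ)² dθ. Then p̄ ≤ 1 − exp(−λ_e·π·c₀^{2/β}·(K·A₀/(2π·(K+1)) + 1/(K+1))^{2/β}). -/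
open Real MeasureTheory ProbabilityTheory

/-- Closed-form upper bound for the averaged spatial secrecy outage probability over a
Rician fading channel: with pattern area `A₀ = ∫₀^{2π} G(θ)² dθ`,
`p̄ ≤ 1 − exp(−λ_e·π·c₀^{2/β}·(K·A₀/(2π(K+1)) + 1/(K+1))^{2/β})`. -/
theorem ssop_upper_bound (K lam_e c₀ β : ℝ) (hK : 0 < K) (hlam : 0 < lam_e)
    (hc₀ : 0 < c₀) (hβ : 2 ≤ β) (G : ℝ → ℝ) (hG : Continuous G) (A : ℝ → ℝ → ℝ)
    (hA : ∀ x y : ℝ, A x y = (1 / 2) * c₀ ^ (2 / β) *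
      ∫ θ in (0 : ℝ)..(2 * π),
        ((K * G θ ^ 2 + x ^ 2 + y ^ 2 + 2 * Real.sqrt K * G θ * x) / (K + 1)) ^ (2 / β))
    (A₀ : ℝ) (hA₀ : A₀ = ∫ θ in (0 : ℝ)..(2 * π), G θ ^ 2) :
    (1 - ∫ x : ℝ, ∫ y : ℝ, Real.exp (-(lam_e * A x y))
        ∂(gaussianReal 0 (1 / 2)) ∂(gaussianReal 0 (1 / 2)))
    ≤ 1 - Real.exp (-(lam_e * π * c₀ ^ (2 / β) *
        (K * A₀ / (2 * π * (K + 1)) + 1 / (K + 1)) ^ (2 / β))) := by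
  have hp0 : 0 < 2 / β := by positivity
  have hp1 : 2 / β ≤ 1 := by rw [div_le_one (by linarith)]; exact hβ
  generalize 2 / β = p at *
  have hpi := Real.pi_pos
  have hA0 : 0 ≤ A₀ := by
    rw [hA₀]
    exact intervalIntegral.integral_nonneg (by positivity) (fun _ _ => sq_nonneg _)
  obtain ⟨m, hm⟩ : ∃ m, m = K * A₀ / (2 * π * (K + 1)) + 1 / (K + 1) := ⟨_, rfl⟩
  have hm0 : 0 < m := by rw [hm]; positivity
  rw [← hm]
  have hsq : Real.sqrt K ^ 2 = K := Real.sq_sqrt hK.le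
  have hnn : ∀ x y θ : ℝ,
      0 ≤ (K * G θ ^ 2 + x ^ 2 + y ^ 2 + 2 * Real.sqrt K * G θ * x) / (K + 1) := by
    intro x y θ
    apply div_nonneg _ (by linarith)
    have : K * G θ ^ 2 + x ^ 2 + y ^ 2 + 2 * Real.sqrt K * G θ * x
        = (Real.sqrt K * G θ + x) ^ 2 + y ^ 2 := by
      rw [add_sq, mul_pow, hsq]; ring
    rw [this]; positivity
  obtain ⟨B, hB⟩ : ∃ B, B = ∫ θ in (0 : ℝ)..(2 * π), G θ := ⟨_, rfl⟩
  have hint : ∀ x y : ℝ, (∫ θ in (0 : ℝ)..(2 * π),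
        ((K * G θ ^ 2 + x ^ 2 + y ^ 2 + 2 * Real.sqrt K * G θ * x) / (K + 1)) ^ p)
      ≤ m ^ p * (2 * π + p / m * ((2 * π * (x ^ 2 + y ^ 2 - 1)
          + 2 * Real.sqrt K * B * x) / (K + 1))) := by
    intro x y
    have h1 : (∫ θ in (0 : ℝ)..(2 * π),
        ((K * G θ ^ 2 + x ^ 2 + y ^ 2 + 2 * Real.sqrt K * G θ * x) / (K + 1)) ^ p)
        ≤ ∫ θ in (0 : ℝ)..(2 * π), ((m ^ p * (p / m) * K / (K + 1)) * G θ ^ 2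
          + (m ^ p * (p / m) * (2 * Real.sqrt K * x) / (K + 1)) * G θ
          + (m ^ p * (1 - p + (p / m) * (x ^ 2 + y ^ 2) / (K + 1)))) := by
      apply intervalIntegral.integral_mono_on (by positivity)
      · apply Continuous.intervalIntegrable
        apply Continuous.rpow_const (by fun_prop)
        intro _; right; exact hp0.le
      · apply Continuous.intervalIntegrable
        fun_prop
      · intro θ _
        have hn := hnn x y θ
        obtain ⟨t, ht⟩ : ∃ t, t =
          (K * G θ ^ 2 + x ^ 2 + y ^ 2 + 2 * Real.sqrt K * G θ * x) / (K + 1) := ⟨_, rfl⟩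
        rw [← ht] at hn ⊢
        have h2 := rpow_one_add_le_one_add_mul_self (s := t / m - 1)
          (by have : 0 ≤ t / m := by positivity
              linarith) hp0.le hp1
        have h3 : t ^ p = m ^ p * (1 + (t / m - 1)) ^ p := by
          rw [← Real.mul_rpow hm0.le (by rw [add_sub_cancel]; positivity)]
          congr 1
          field_simp
          ring
        rw [h3]
        refine (mul_le_mul_of_nonneg_left h2 (by positivity)).trans (le_of_eq ?_)
        rw [ht]
        field_simp
        ring
    refine h1.trans (le_of_eq ?_)
    have i1 : ∀ c : ℝ, IntervalIntegrable (fun θ => c * G θ ^ 2) volume 0 (2 * π) :=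
      fun c => Continuous.intervalIntegrable (by fun_prop) _ _
    have i2 : ∀ c : ℝ, IntervalIntegrable (fun θ => c * G θ) volume 0 (2 * π) :=
      fun c => Continuous.intervalIntegrable (by fun_prop) _ _
    rw [intervalIntegral.integral_add ((i1 _).add (i2 _)) (by simp),
      intervalIntegral.integral_add (i1 _) (i2 _), intervalIntegral.integral_const_mul,
      intervalIntegral.integral_const_mul, intervalIntegral.integral_const, ← hA₀, ← hB]
    have hKA : K * A₀ = 2 * π * (m * (K + 1) - 1) := by rw [hm]; field_simp; ring
    have : m ^ p * (p / m) * K / (K + 1) * A₀ = m ^ p * (p / m) / (K + 1) * (K * A₀) := by ring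
    rw [this, hKA, smul_eq_mul]
    field_simp
    ring
  obtain ⟨E, hE⟩ : ∃ E, E = lam_e * π * c₀ ^ p * m ^ p := ⟨_, rfl⟩
  rw [← hE]
  obtain ⟨a, b, hab⟩ : ∃ a b : ℝ, ∀ x y : ℝ,
      Real.exp (-E) * (1 + a * (x ^ 2 + y ^ 2 - 1) + b * x) ≤ Real.exp (-(lam_e * A x y)) := by
    refine ⟨-(lam_e * (1 / 2) * c₀ ^ p * m ^ p * (p / m) * (2 * π) / (K + 1)),
      -(lam_e * (1 / 2) * c₀ ^ p * m ^ p * (p / m) * (2 * Real.sqrt K * B) / (K + 1)), ?_⟩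
    intro x y
    have h1 : lam_e * A x y ≤ lam_e * ((1 / 2) * c₀ ^ p * (m ^ p * (2 * π + p / m *
        ((2 * π * (x ^ 2 + y ^ 2 - 1) + 2 * Real.sqrt K * B * x) / (K + 1))))) := by
      rw [hA]
      have := hint x y
      gcongr
    have h2 : Real.exp (-(lam_e * A x y))
        = Real.exp (-E) * Real.exp (E - lam_e * A x y) := by
      rw [← Real.exp_add]; congr 1; ring
    rw [h2]
    apply mul_le_mul_of_nonneg_left _ (Real.exp_pos _).le
    refine le_trans ?_ (Real.add_one_le_exp _)
    have h3 : E - lam_e * ((1 / 2) * c₀ ^ p * (m ^ p * (2 * π + p / m *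
        ((2 * π * (x ^ 2 + y ^ 2 - 1) + 2 * Real.sqrt K * B * x) / (K + 1))))) + 1 =
        1 + -(lam_e * (1 / 2) * c₀ ^ p * m ^ p * (p / m) * (2 * π) / (K + 1))
          * (x ^ 2 + y ^ 2 - 1)
        + -(lam_e * (1 / 2) * c₀ ^ p * m ^ p * (p / m) * (2 * Real.sqrt K * B) / (K + 1)) * x := by
      rw [hE]; ring
    rw [← h3]
    linarith
  have hAnn : ∀ x y, 0 ≤ A x y := by
    intro x y
    rw [hA]
    have := intervalIntegral.integral_nonneg (μ := volume) (a := 0) (b := 2 * π)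
      (by positivity) (fun θ _ => Real.rpow_nonneg (hnn x y θ) p)
    positivity
  have hcont : Continuous (fun z : ℝ × ℝ => Real.exp (-(lam_e * A z.1 z.2))) := by
    simp_rw [hA]
    apply Real.continuous_exp.comp
    apply Continuous.neg
    apply Continuous.mul continuous_const
    apply Continuous.mul continuous_const
    apply intervalIntegral.continuous_parametric_intervalIntegral_of_continuous'
    apply Continuous.rpow_const (by fun_prop)
    intro _; right; exact hp0.le
  obtain ⟨μ, hμ⟩ : ∃ μ, μ = gaussianReal 0 (1 / 2) := ⟨_, rfl⟩
  have hprob : IsProbabilityMeasure μ := by rw [hμ]; infer_instance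
  have L2 : MemLp (fun x : ℝ => x) 2 μ := by
    rw [hμ]; exact memLp_id_gaussianReal 2
  have I2 : Integrable (fun x : ℝ => x ^ 2) μ := L2.integrable_sq
  have I1 : Integrable (fun x : ℝ => x) μ := L2.integrable (by norm_num)
  have E1 : ∫ x, x ∂μ = 0 := by rw [hμ]; exact integral_id_gaussianReal
  have E2 : ∫ x, x ^ 2 ∂μ = 1 / 2 := by
    have hv := variance_eq_sub (μ := μ) (X := fun x : ℝ => x) L2
    rw [E1] at hv
    have hv2 : variance (fun x : ℝ => x) μ = 1 / 2 := by
      rw [hμ, variance_fun_id_gaussianReal]; norm_num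
    rw [hv2] at hv
    simpa using hv.symm
  rw [← hμ]
  have J : Integrable (fun z : ℝ × ℝ => Real.exp (-(lam_e * A z.1 z.2))) (μ.prod μ) := by
    apply Integrable.of_bound hcont.aestronglyMeasurable 1
    refine Filter.Eventually.of_forall fun z => ?_
    rw [Real.norm_eq_abs, abs_of_pos (Real.exp_pos _), Real.exp_le_one_iff]
    have := hAnn z.1 z.2
    have : 0 ≤ lam_e * A z.1 z.2 := by positivity
    linarith
  have Q : ∀ u v : ℝ, ∫ x, (u + v * x ^ 2) ∂μ = u + v / 2 := by
    intro u v
    have h : ∫ x, v * x ^ 2 ∂μ = v / 2 := by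
      rw [integral_const_mul, E2]; ring
    rw [integral_add (integrable_const _) (I2.const_mul _), h]
    simp
  have hy : ∀ x : ℝ, Real.exp (-E) * (1 - a / 2 + a * x ^ 2 + b * x)
      ≤ ∫ y, Real.exp (-(lam_e * A x y)) ∂μ := by
    intro x
    have e : ∫ y, ((Real.exp (-E) * (1 - a + a * x ^ 2 + b * x)) + (Real.exp (-E) * a) * y ^ 2) ∂μ
        = Real.exp (-E) * (1 - a / 2 + a * x ^ 2 + b * x) := by
      rw [Q]
      ring
    rw [← e]
    apply integral_mono
    · exact (integrable_const _).add (I2.const_mul _)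
    · apply Integrable.of_bound
        (hcont.comp (Continuous.prodMk_right x)).aestronglyMeasurable 1
      refine Filter.Eventually.of_forall fun y => ?_
      simp only [Function.comp]
      rw [Real.norm_eq_abs, abs_of_pos (Real.exp_pos _), Real.exp_le_one_iff]
      have := hAnn x y
      have : 0 ≤ lam_e * A x y := by positivity
      linarith
    · intro y
      refine le_trans (le_of_eq ?_) (hab x y)
      ring
  have fin : Real.exp (-E) ≤ ∫ x, ∫ y, Real.exp (-(lam_e * A x y)) ∂μ ∂μ := by
    have e : ∫ x, ((Real.exp (-E) * (1 - a / 2)) + (Real.exp (-E) * a) * x ^ 2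
        + (Real.exp (-E) * b) * x) ∂μ = Real.exp (-E) := by
      have S : Integrable (fun x : ℝ => Real.exp (-E) * (1 - a / 2)
          + (Real.exp (-E) * a) * x ^ 2) μ := (integrable_const _).add (I2.const_mul _)
      rw [integral_add S (I1.const_mul _), Q, integral_const_mul, E1]
      ring
    calc Real.exp (-E) = _ := e.symm
      _ ≤ _ := by
        apply integral_mono
        · exact ((integrable_const _).add (I2.const_mul _)).add (I1.const_mul _)
        · exact J.integral_prod_left
        · intro x
          refine le_trans (le_of_eq ?_) (hy x)
          ring
  linarith
end

section
/- Let λ_e > 0, c₀ > 0 and β ≥ 2. If X and Y are independent random variables, each distributed according to the real Gaussian measure with mean 0 and variance 1/2, then E[exp(−λ_e·π·(c₀·(X² + Y²))^{2/β})] ≥ exp(−λ_e·π·c₀^{2/β}); equivalently, in the Rayleigh fading case (K = 0) the averaged spatial secrecy outage probability p̄ = 1 − E[exp(−λ_e·π·(c₀·(X²+Y²))^{2/β})] satisfies p̄ ≤ 1 − exp(−λ_e·π·c₀^{2/β}). -/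
open Real MeasureTheory ProbabilityTheory

lemma aux_gauss_sq : Integrable (fun x : ℝ => x ^ 2) (gaussianReal 0 (1 / 2)) ∧
    ∫ x, x ^ 2 ∂(gaussianReal 0 (1 / 2)) = 1 / 2 := by
  have hm : MemLp id 2 (gaussianReal 0 (1 / 2)) := memLp_id_gaussianReal 2
  refine ⟨by simpa using hm.integrable_sq, ?_⟩
  have hv := variance_id_gaussianReal (μ := 0) (v := 1 / 2)
  rw [variance_eq_sub hm] at hv
  simpa using hv

/-- For the Rayleigh fading case (`K = 0`), with `X, Y` independent `𝒩(0, 1/2)`,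
`E[exp(−λ_e·π·(c₀·(X² + Y²))^{2/β})] ≥ exp(−λ_e·π·c₀^{2/β})`; equivalently the averaged
spatial secrecy outage probability `p̄ = 1 − E[exp(−λ_e·π·(c₀·(X²+Y²))^{2/β})]` satisfies
`p̄ ≤ 1 − exp(−λ_e·π·c₀^{2/β})`. -/
theorem rayleigh_ssop_upper_bound (lam_e c₀ β : ℝ) (hlam : 0 < lam_e) (hc₀ : 0 < c₀)
    (hβ : 2 ≤ β) :
    (∫ p : ℝ × ℝ, Real.exp (-(lam_e * π * (c₀ * (p.1 ^ 2 + p.2 ^ 2)) ^ (2 / β)))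
        ∂((gaussianReal 0 (1 / 2)).prod (gaussianReal 0 (1 / 2))))
      ≥ Real.exp (-(lam_e * π * c₀ ^ (2 / β))) ∧
    (1 - ∫ p : ℝ × ℝ, Real.exp (-(lam_e * π * (c₀ * (p.1 ^ 2 + p.2 ^ 2)) ^ (2 / β)))
        ∂((gaussianReal 0 (1 / 2)).prod (gaussianReal 0 (1 / 2))))
      ≤ 1 - Real.exp (-(lam_e * π * c₀ ^ (2 / β))) := by
  have key : (∫ p : ℝ × ℝ, Real.exp (-(lam_e * π * (c₀ * (p.1 ^ 2 + p.2 ^ 2)) ^ (2 / β)))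
        ∂((gaussianReal 0 (1 / 2)).prod (gaussianReal 0 (1 / 2))))
      ≥ Real.exp (-(lam_e * π * c₀ ^ (2 / β))) := by
    obtain ⟨hi, hI⟩ := aux_gauss_sq
    have hb : 0 < β := by linarith
    have ha0 : 0 ≤ 2 / β := by positivity
    have ha1 : 2 / β ≤ 1 := by rw [div_le_one hb]; exact hβ
    set a := 2 / β with ha
    set C := lam_e * π * c₀ ^ a with hC
    have hC0 : 0 ≤ C := by positivity
    have h1 : Integrable (fun p : ℝ × ℝ => p.1 ^ 2)
        ((gaussianReal 0 (1 / 2)).prod (gaussianReal 0 (1 / 2))) := hi.comp_fst _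
    have h2 : Integrable (fun p : ℝ × ℝ => p.2 ^ 2)
        ((gaussianReal 0 (1 / 2)).prod (gaussianReal 0 (1 / 2))) := hi.comp_snd _
    have h12 : Integrable (fun p : ℝ × ℝ => p.1 ^ 2 + p.2 ^ 2)
        ((gaussianReal 0 (1 / 2)).prod (gaussianReal 0 (1 / 2))) := h1.add h2
    have hE : ∫ p : ℝ × ℝ, (p.1 ^ 2 + p.2 ^ 2)
        ∂((gaussianReal 0 (1 / 2)).prod (gaussianReal 0 (1 / 2))) = 1 := by
      rw [integral_add h1 h2, integral_fun_fst (fun x : ℝ => x ^ 2),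
        integral_fun_snd (fun x : ℝ => x ^ 2), hI]
      simp
      norm_num
    have hrw : Real.exp (-C) = ∫ p : ℝ × ℝ,
        (Real.exp (-C) * (1 + C * a) - Real.exp (-C) * C * a * (p.1 ^ 2 + p.2 ^ 2))
        ∂((gaussianReal 0 (1 / 2)).prod (gaussianReal 0 (1 / 2))) := by
      rw [integral_sub (integrable_const _) (h12.const_mul _), integral_const, integral_const_mul, hE]
      simp
      ring
    rw [ge_iff_le, hrw]
    refine integral_mono ((integrable_const _).sub (h12.const_mul _)) ?_ ?_
    · refine Integrable.of_bound (C := 1) (by fun_prop) (Filter.Eventually.of_forall fun p => ?_)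
      rw [Real.norm_eq_abs, abs_of_pos (Real.exp_pos _), Real.exp_le_one_iff, neg_nonpos]
      positivity
    · intro p
      have ht : 0 ≤ p.1 ^ 2 + p.2 ^ 2 := by positivity
      show Real.exp (-C) * (1 + C * a) - Real.exp (-C) * C * a * (p.1 ^ 2 + p.2 ^ 2) ≤
        Real.exp (-(lam_e * π * (c₀ * (p.1 ^ 2 + p.2 ^ 2)) ^ a))
      generalize p.1 ^ 2 + p.2 ^ 2 = t at ht
      have hber := _root_.rpow_one_add_le_one_add_mul_self (s := t - 1) (by linarith) ha0 ha1
      rw [add_sub_cancel] at hber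
      rw [Real.mul_rpow hc₀.le ht, ← mul_assoc (lam_e * π) (c₀ ^ a) (t ^ a), ← hC]
      have h3 : C * t ^ a ≤ C * (1 + a * (t - 1)) := mul_le_mul_of_nonneg_left hber hC0
      calc _ = Real.exp (-C) * (-(C * a * (t - 1)) + 1) := by ring
        _ ≤ Real.exp (-C) * Real.exp (-(C * a * (t - 1))) :=
          mul_le_mul_of_nonneg_left (Real.add_one_le_exp _) (Real.exp_pos _).le
        _ = Real.exp (-(C * (1 + a * (t - 1)))) := by rw [← Real.exp_add]; congr 1; ring
        _ ≤ _ := Real.exp_le_exp.mpr (by linarith)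
  exact ⟨key, by linarith [key]⟩
end

section
/- Let λ_e > 0, c₀ > 0, β ≥ 2, let G : ℝ → ℝ be continuous, and let μ be the real Gaussian measure with mean 0 and variance 1/2. Define for K > 0 the averaged SSOP p̄(K) = 1 − ∫∫ exp(−(λ_e/2)·c₀^{2/β}·∫₀^{2π} ((K·G(θ)² + x² + y² + 2·√K·G(θ)·x)/(K+1))^{2/β} dθ) dμ(x) dμ(y). Then p̄(K) tends to the deterministic-channel value 1 − exp(−(λ_e/2)·c₀^{2/β}·∫₀^{2π} (G(θ)²)^{2/β} dθ) as K → ∞. -/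
open Real Filter MeasureTheory ProbabilityTheory

lemma aux_base_tendsto (g x y : ℝ) :
    Tendsto (fun K : ℝ => (K * g ^ 2 + x ^ 2 + y ^ 2 + 2 * Real.sqrt K * g * x) / (K + 1))
      atTop (nhds (g ^ 2)) := by
  have h1 : Tendsto (fun K : ℝ => (K + 1)⁻¹) atTop (nhds 0) :=
    tendsto_inv_atTop_zero.comp (tendsto_atTop_add_const_right _ _ tendsto_id)
  have h2 : Tendsto (fun K : ℝ => (Real.sqrt K)⁻¹) atTop (nhds 0) :=
    tendsto_inv_atTop_zero.comp Real.tendsto_sqrt_atTop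
  have h3 : Tendsto (fun K : ℝ => (1 - (K + 1)⁻¹) * g ^ 2 + (x ^ 2 + y ^ 2) * (K + 1)⁻¹
      + 2 * g * x * ((Real.sqrt K)⁻¹ * (1 - (K + 1)⁻¹))) atTop
      (nhds ((1 - 0) * g ^ 2 + (x ^ 2 + y ^ 2) * 0 + 2 * g * x * (0 * (1 - 0)))) :=
    (((h1.const_sub 1).mul_const _).add (h1.const_mul _)).add
      ((h2.mul (h1.const_sub 1)).const_mul _)
  have e : (1 - 0) * g ^ 2 + (x ^ 2 + y ^ 2) * 0 + 2 * g * x * (0 * (1 - 0)) = g ^ 2 := by ring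
  rw [e] at h3
  refine h3.congr' ?_
  filter_upwards [eventually_gt_atTop 0] with K hK
  have hs : 0 < Real.sqrt K := Real.sqrt_pos.2 hK
  have hK1 : K + 1 ≠ 0 := by positivity
  have hsq : K = Real.sqrt K ^ 2 := (Real.sq_sqrt hK.le).symm
  generalize Real.sqrt K = s at *
  subst hsq
  field_simp
  ring

lemma aux_base_nonneg (K g x y : ℝ) (hK : 0 ≤ K) :
    0 ≤ (K * g ^ 2 + x ^ 2 + y ^ 2 + 2 * Real.sqrt K * g * x) / (K + 1) := by
  have hsq := Real.sq_sqrt hK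
  apply div_nonneg _ (by positivity)
  nlinarith [sq_nonneg (Real.sqrt K * g + x), sq_nonneg y]

lemma aux_base_le (K g x y : ℝ) (hK : 0 ≤ K) :
    (K * g ^ 2 + x ^ 2 + y ^ 2 + 2 * Real.sqrt K * g * x) / (K + 1)
      ≤ 2 * g ^ 2 + 2 * x ^ 2 + y ^ 2 := by
  have hsq := Real.sq_sqrt hK
  rw [div_le_iff₀ (by positivity)]
  nlinarith [sq_nonneg (Real.sqrt K * g - x), mul_nonneg hK (sq_nonneg x),
    mul_nonneg hK (sq_nonneg y), sq_nonneg g]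

lemma aux_theta_tendsto (p : ℝ) (hp : 0 ≤ p) (G : ℝ → ℝ) (hG : Continuous G) (x y : ℝ) :
    Tendsto (fun K : ℝ => ∫ θ in (0 : ℝ)..(2 * π),
      ((K * G θ ^ 2 + x ^ 2 + y ^ 2 + 2 * Real.sqrt K * G θ * x) / (K + 1)) ^ p) atTop
      (nhds (∫ θ in (0 : ℝ)..(2 * π), (G θ ^ 2) ^ p)) := by
  apply intervalIntegral.tendsto_integral_filter_of_dominated_convergence
    (fun θ => (2 * G θ ^ 2 + 2 * x ^ 2 + y ^ 2) ^ p)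
  · refine Eventually.of_forall fun K => Continuous.aestronglyMeasurable ?_
    exact Continuous.rpow_const (by fun_prop) (fun _ => Or.inr hp)
  · filter_upwards [eventually_ge_atTop 0] with K hK
    refine Eventually.of_forall fun θ _ => ?_
    have h0 := aux_base_nonneg K (G θ) x y hK
    rw [Real.norm_of_nonneg (Real.rpow_nonneg h0 _)]
    exact Real.rpow_le_rpow h0 (aux_base_le K (G θ) x y hK) hp
  · apply Continuous.intervalIntegrable
    exact Continuous.rpow_const (by fun_prop) (fun _ => Or.inr hp)
  · refine Eventually.of_forall fun θ _ => ?_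
    exact (aux_base_tendsto (G θ) x y).rpow_const (Or.inr hp)

lemma aux_cont (C p : ℝ) (hp : 0 ≤ p) (G : ℝ → ℝ) (hG : Continuous G) (K : ℝ) :
    Continuous (fun q : ℝ × ℝ => Real.exp (-(C * ∫ θ in (0 : ℝ)..(2 * π),
      ((K * G θ ^ 2 + q.1 ^ 2 + q.2 ^ 2 + 2 * Real.sqrt K * G θ * q.1) / (K + 1)) ^ p))) := by
  have h : Continuous (fun q : ℝ × ℝ => ∫ θ in (0 : ℝ)..(2 * π),
      ((K * G θ ^ 2 + q.1 ^ 2 + q.2 ^ 2 + 2 * Real.sqrt K * G θ * q.1) / (K + 1)) ^ p) := by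
    apply intervalIntegral.continuous_parametric_intervalIntegral_of_continuous'
    exact Continuous.rpow_const (by fun_prop) (fun _ => Or.inr hp)
  fun_prop

lemma aux_norm_le (C p : ℝ) (hC : 0 ≤ C) (G : ℝ → ℝ) (K : ℝ) (hK : 0 ≤ K) (x y : ℝ) :
    ‖Real.exp (-(C * ∫ θ in (0 : ℝ)..(2 * π),
      ((K * G θ ^ 2 + x ^ 2 + y ^ 2 + 2 * Real.sqrt K * G θ * x) / (K + 1)) ^ p))‖ ≤ 1 := by
  rw [Real.norm_of_nonneg (Real.exp_nonneg _), Real.exp_le_one_iff, neg_nonpos]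
  refine mul_nonneg hC (intervalIntegral.integral_nonneg (by positivity) fun θ _ => ?_)
  exact Real.rpow_nonneg (aux_base_nonneg K (G θ) x y hK) _

lemma aux_main (C p : ℝ) (hC : 0 ≤ C) (hp : 0 ≤ p) (G : ℝ → ℝ) (hG : Continuous G)
    (μ : Measure ℝ) [IsProbabilityMeasure μ] :
    Tendsto (fun K : ℝ => ∫ x : ℝ, ∫ y : ℝ, Real.exp (-(C * ∫ θ in (0 : ℝ)..(2 * π),
      ((K * G θ ^ 2 + x ^ 2 + y ^ 2 + 2 * Real.sqrt K * G θ * x) / (K + 1)) ^ p)) ∂μ ∂μ) atTop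
      (nhds (Real.exp (-(C * ∫ θ in (0 : ℝ)..(2 * π), (G θ ^ 2) ^ p)))) := by
  have inner : ∀ x : ℝ, Tendsto (fun K : ℝ => ∫ y : ℝ,
      Real.exp (-(C * ∫ θ in (0 : ℝ)..(2 * π),
      ((K * G θ ^ 2 + x ^ 2 + y ^ 2 + 2 * Real.sqrt K * G θ * x) / (K + 1)) ^ p)) ∂μ) atTop
      (nhds (∫ _ : ℝ, Real.exp (-(C * ∫ θ in (0 : ℝ)..(2 * π), (G θ ^ 2) ^ p)) ∂μ)) := by
    intro x
    apply tendsto_integral_filter_of_dominated_convergence (fun _ => (1 : ℝ))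
    · exact Eventually.of_forall fun K =>
        ((aux_cont C p hp G hG K).comp (Continuous.prodMk_right x)).aestronglyMeasurable
    · filter_upwards [eventually_ge_atTop 0] with K hK
      exact Eventually.of_forall fun y => aux_norm_le C p hC G K hK x y
    · exact integrable_const _
    · refine Eventually.of_forall fun y => ?_
      exact (Real.continuous_exp.tendsto _).comp
        ((aux_theta_tendsto p hp G hG x y).const_mul C).neg
  have outer : Tendsto (fun K : ℝ => ∫ x : ℝ, ∫ y : ℝ,
      Real.exp (-(C * ∫ θ in (0 : ℝ)..(2 * π),
      ((K * G θ ^ 2 + x ^ 2 + y ^ 2 + 2 * Real.sqrt K * G θ * x) / (K + 1)) ^ p)) ∂μ ∂μ) atTop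
      (nhds (∫ _ : ℝ, ∫ _ : ℝ,
        Real.exp (-(C * ∫ θ in (0 : ℝ)..(2 * π), (G θ ^ 2) ^ p)) ∂μ ∂μ)) := by
    apply tendsto_integral_filter_of_dominated_convergence (fun _ => (1 : ℝ))
    · refine Eventually.of_forall fun K => ?_
      exact ((aux_cont C p hp G hG K).stronglyMeasurable.integral_prod_right
        (ν := μ)).aestronglyMeasurable
    · filter_upwards [eventually_ge_atTop 0] with K hK
      refine Eventually.of_forall fun x => ?_
      have := norm_integral_le_of_norm_le_const (μ := μ)
        (Eventually.of_forall fun y => aux_norm_le C p hC G K hK x y)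
      simpa using this
    · exact integrable_const _
    · exact Eventually.of_forall inner
  simpa using outer

/-- As the Rician factor `K → ∞`, the averaged spatial secrecy outage probability
`p̄(K)` (an expectation over the two independent Gaussian `𝒩(0, 1/2)` NLOS components)
tends to the deterministic-channel value
`1 − exp(−(λ_e/2)·c₀^{2/β}·∫₀^{2π} (G(θ)²)^{2/β} dθ)`. -/
theorem ssop_tendsto_deterministic (lam_e c₀ β : ℝ) (hlam : 0 < lam_e) (hc₀ : 0 < c₀)
    (hβ : 2 ≤ β) (G : ℝ → ℝ) (hG : Continuous G) :
    Tendsto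
      (fun K : ℝ => 1 - ∫ x : ℝ, ∫ y : ℝ,
        Real.exp (-((lam_e / 2) * c₀ ^ (2 / β) *
          ∫ θ in (0 : ℝ)..(2 * π),
            ((K * G θ ^ 2 + x ^ 2 + y ^ 2 + 2 * Real.sqrt K * G θ * x) / (K + 1))
              ^ (2 / β)))
        ∂(gaussianReal 0 (1 / 2)) ∂(gaussianReal 0 (1 / 2)))
      atTop
      (nhds (1 - Real.exp (-((lam_e / 2) * c₀ ^ (2 / β) *
        ∫ θ in (0 : ℝ)..(2 * π), (G θ ^ 2) ^ (2 / β))))) := by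
  have hp : 0 ≤ 2 / β := by positivity
  have hC : 0 ≤ (lam_e / 2) * c₀ ^ (2 / β) := by positivity
  exact (aux_main _ _ hC hp G hG _).const_sub 1
end

section
/- Let λ_e > 0, c₀ > 0, β ≥ 2, let G : ℝ → ℝ be continuous, and let μ be the real Gaussian measure with mean 0 and variance 1/2. Define for K > 0 the averaged SSOP p̄(K) = 1 − ∫∫ exp(−(λ_e/2)·c₀^{2/β}·∫₀^{2π} ((K·G(θ)² + x² + y² + 2·√K·G(θ)·x)/(K+1))^{2/β} dθ) dμ(x) dμ(y). Then p̄(K) tends to the Rayleigh-channel value 1 − ∫∫ exp(−λ_e·π·(c₀·(x² + y²))^{2/β}) dμ(x) dμ(y) as K → 0⁺. -/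
open Real Filter MeasureTheory ProbabilityTheory

theorem ssop_aux (a p : ℝ) (ha : 0 ≤ a) (hp : 0 < p) (G : ℝ → ℝ) (hG : Continuous G)
    (μ : Measure ℝ) [IsProbabilityMeasure μ] :
    Continuous (fun K : ℝ => ∫ x : ℝ, ∫ y : ℝ,
        Real.exp (-(a *
          ∫ θ in (0 : ℝ)..(2 * π),
            ((|K| * G θ ^ 2 + x ^ 2 + y ^ 2 + 2 * Real.sqrt |K| * G θ * x) / (|K| + 1))
              ^ p)) ∂μ ∂μ) := by
  have hF : Continuous (fun q : (ℝ × ℝ × ℝ) => Real.exp (-(a *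
          ∫ θ in (0 : ℝ)..(2 * π),
            ((|q.1| * G θ ^ 2 + q.2.1 ^ 2 + q.2.2 ^ 2 + 2 * Real.sqrt |q.1| * G θ * q.2.1)
              / (|q.1| + 1)) ^ p))) := by
    refine Real.continuous_exp.comp (Continuous.neg (continuous_const.mul ?_))
    apply intervalIntegral.continuous_parametric_intervalIntegral_of_continuous'
    refine Continuous.rpow_const ?_ (fun _ => Or.inr hp.le)
    refine Continuous.div (by fun_prop) (by fun_prop) ?_
    intro q
    positivity
  have hB : ∀ K x y : ℝ, ‖Real.exp (-(a *
          ∫ θ in (0 : ℝ)..(2 * π),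
            ((|K| * G θ ^ 2 + x ^ 2 + y ^ 2 + 2 * Real.sqrt |K| * G θ * x) / (|K| + 1))
              ^ p))‖ ≤ 1 := by
    intro K x y
    rw [Real.norm_eq_abs, Real.abs_exp, Real.exp_le_one_iff, neg_nonpos]
    refine mul_nonneg ha (intervalIntegral.integral_nonneg (by positivity) ?_)
    intro θ _
    apply Real.rpow_nonneg
    refine div_nonneg ?_ (by positivity)
    have h := Real.sq_sqrt (abs_nonneg K)
    have e : |K| * G θ ^ 2 + x ^ 2 + y ^ 2 + 2 * Real.sqrt |K| * G θ * x
        = (Real.sqrt |K| * G θ + x) ^ 2 + y ^ 2 := by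
      linear_combination (-(G θ ^ 2)) * h
    rw [e]
    positivity
  have hI : Continuous (fun q : ℝ × ℝ => ∫ y : ℝ, Real.exp (-(a *
          ∫ θ in (0 : ℝ)..(2 * π),
            ((|q.1| * G θ ^ 2 + q.2 ^ 2 + y ^ 2 + 2 * Real.sqrt |q.1| * G θ * q.2)
              / (|q.1| + 1)) ^ p)) ∂μ) := by
    refine continuous_of_dominated (bound := fun _ => 1) ?_ ?_ (integrable_const _) ?_
    · intro q
      exact (hF.comp (f := fun y : ℝ => (q.1, q.2, y)) (by fun_prop)).aestronglyMeasurable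
    · intro q
      exact Eventually.of_forall fun y => hB q.1 q.2 y
    · exact Eventually.of_forall fun y =>
        hF.comp (f := fun q : ℝ × ℝ => (q.1, q.2, y)) (by fun_prop)
  refine continuous_of_dominated (bound := fun _ => 1) ?_ ?_ (integrable_const _) ?_
  · intro K
    exact (hI.comp (f := fun x : ℝ => (K, x)) (by fun_prop)).aestronglyMeasurable
  · intro K
    refine Eventually.of_forall fun x => ?_
    have := norm_integral_le_of_norm_le_const (μ := μ) (Eventually.of_forall fun y => hB K x y)
    simpa using this
  · exact Eventually.of_forall fun x => hI.comp (f := fun K : ℝ => (K, x)) (by fun_prop)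

/-- As the Rician factor `K → 0⁺`, the averaged spatial secrecy outage probability
`p̄(K)` (an expectation over the two independent Gaussian `𝒩(0, 1/2)` NLOS components)
tends to the Rayleigh-channel value
`1 − ∫∫ exp(−λ_e·π·(c₀·(x² + y²))^{2/β}) dμ(x) dμ(y)`. -/
theorem ssop_tendsto_rayleigh (lam_e c₀ β : ℝ) (hlam : 0 < lam_e) (hc₀ : 0 < c₀)
    (hβ : 2 ≤ β) (G : ℝ → ℝ) (hG : Continuous G) :
    Tendsto
      (fun K : ℝ => 1 - ∫ x : ℝ, ∫ y : ℝ,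
        Real.exp (-((lam_e / 2) * c₀ ^ (2 / β) *
          ∫ θ in (0 : ℝ)..(2 * π),
            ((K * G θ ^ 2 + x ^ 2 + y ^ 2 + 2 * Real.sqrt K * G θ * x) / (K + 1))
              ^ (2 / β)))
        ∂(gaussianReal 0 (1 / 2)) ∂(gaussianReal 0 (1 / 2)))
      (nhdsWithin 0 (Set.Ioi 0))
      (nhds (1 - ∫ x : ℝ, ∫ y : ℝ,
        Real.exp (-(lam_e * π * (c₀ * (x ^ 2 + y ^ 2)) ^ (2 / β)))
        ∂(gaussianReal 0 (1 / 2)) ∂(gaussianReal 0 (1 / 2)))) := by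
  have hp : 0 < 2 / β := by positivity
  have ha : 0 ≤ (lam_e / 2) * c₀ ^ (2 / β) := by positivity
  have h := (ssop_aux _ _ ha hp G hG (gaussianReal 0 (1 / 2))).tendsto 0
  refine Tendsto.const_sub 1 ?_
  have h2 := h.mono_left (nhdsWithin_le_nhds (s := Set.Ioi (0 : ℝ)))
  convert h2.congr' ?_ using 2
  · refine integral_congr_ae (Eventually.of_forall fun x => ?_)
    refine integral_congr_ae (Eventually.of_forall fun y => ?_)
    have hxy : 0 ≤ x ^ 2 + y ^ 2 := by positivity
    simp only [abs_zero, Real.sqrt_zero, zero_mul, mul_zero, zero_add, add_zero, div_one,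
      intervalIntegral.integral_const, smul_eq_mul, sub_zero]
    rw [Real.mul_rpow hc₀.le hxy]
    congr 1
    ring
  · filter_upwards [self_mem_nhdsWithin] with K hK
    rw [abs_of_pos hK]
end

section
/- Let c₀ > 0, β ≥ 2, let G : ℝ → ℝ be continuous, and set A₀ = ∫₀^{2π} G(θ)² dθ. Then the deterministic-channel exposure-region area satisfies (1/2)·∫₀^{2π} (c₀·G(θ)²)^{2/β} dθ ≤ π·((c₀/(2π))·A₀)^{2/β}; consequently, for any λ_e > 0, 1 − exp(−λ_e·(1/2)·∫₀^{2π}(c₀·G(θ)²)^{2/β} dθ) ≤ 1 − exp(−λ_e·π·((c₀/(2π))·A₀)^{2/β}). Moreover, when β = 2 both inequalities hold with equality, so the SSOP upper bound is exact for the deterministic channel with path-loss exponent 2. -/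
open Real MeasureTheory intervalIntegral

/-- In the deterministic channel (`K = ∞`), the exposure-region area satisfies
`(1/2)·∫₀^{2π} (c₀·G(θ)²)^{2/β} dθ ≤ π·((c₀/(2π))·A₀)^{2/β}` where
`A₀ = ∫₀^{2π} G(θ)² dθ`; consequently the SSOP is bounded by its closed-form upper
bound, and when `β = 2` both inequalities hold with equality. -/
theorem deterministic_area_bound (c₀ β : ℝ) (hc₀ : 0 < c₀) (hβ : 2 ≤ β)
    (G : ℝ → ℝ) (hG : Continuous G) (A₀ : ℝ)
    (hA₀ : A₀ = ∫ θ in (0 : ℝ)..(2 * π), G θ ^ 2) :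
    ((1 / 2) * ∫ θ in (0 : ℝ)..(2 * π), (c₀ * G θ ^ 2) ^ (2 / β))
      ≤ π * ((c₀ / (2 * π)) * A₀) ^ (2 / β) ∧
    (∀ lam_e : ℝ, 0 < lam_e →
      1 - Real.exp (-(lam_e * ((1 / 2) * ∫ θ in (0 : ℝ)..(2 * π),
          (c₀ * G θ ^ 2) ^ (2 / β))))
        ≤ 1 - Real.exp (-(lam_e * π * ((c₀ / (2 * π)) * A₀) ^ (2 / β)))) ∧
    (β = 2 →
      ((1 / 2) * ∫ θ in (0 : ℝ)..(2 * π), (c₀ * G θ ^ 2) ^ (2 / β))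
        = π * ((c₀ / (2 * π)) * A₀) ^ (2 / β) ∧
      ∀ lam_e : ℝ, 0 < lam_e →
        1 - Real.exp (-(lam_e * ((1 / 2) * ∫ θ in (0 : ℝ)..(2 * π),
            (c₀ * G θ ^ 2) ^ (2 / β))))
          = 1 - Real.exp (-(lam_e * π * ((c₀ / (2 * π)) * A₀) ^ (2 / β)))) := by
  have hpi : 0 < π := Real.pi_pos
  have hb : 0 < β := by linarith
  have hp0 : 0 < 2 / β := by positivity
  have hp1 : 2 / β ≤ 1 := by rw [div_le_one hb]; exact hβ
  have hfc : Continuous fun θ => c₀ * G θ ^ 2 := by fun_prop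
  have hgc : Continuous fun θ => (c₀ * G θ ^ 2) ^ (2 / β) :=
    hfc.rpow_const fun _ => Or.inr hp0.le
  have key : ((1 / 2) * ∫ θ in (0 : ℝ)..(2 * π), (c₀ * G θ ^ 2) ^ (2 / β))
      ≤ π * ((c₀ / (2 * π)) * A₀) ^ (2 / β) := by
    have hle : (0 : ℝ) ≤ 2 * π := by positivity
    have hJ := (Real.concaveOn_rpow hp0.le hp1).le_map_set_average (μ := volume)
      (t := Set.uIoc 0 (2 * π)) (f := fun θ => c₀ * G θ ^ 2)
      (Real.continuous_rpow_const hp0.le).continuousOn isClosed_Ici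
      (by rw [Set.uIoc_of_le hle, Real.volume_Ioc]; simp [hpi])
      (by rw [Set.uIoc_of_le hle, Real.volume_Ioc]; exact ENNReal.ofReal_ne_top)
      (Filter.Eventually.of_forall fun θ => by
        simp only [Set.mem_Ici]; positivity)
      (intervalIntegrable_iff.1 (hfc.intervalIntegrable _ _))
      (intervalIntegrable_iff.1 (hgc.intervalIntegrable _ _))
    rw [interval_average_eq_div, interval_average_eq_div,
      intervalIntegral.integral_const_mul, ← hA₀, sub_zero,
      div_le_iff₀ (by positivity)] at hJ
    have e : c₀ / (2 * π) * A₀ = c₀ * A₀ / (2 * π) := by ring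
    rw [e]
    linarith
  have keq : β = 2 → ((1 / 2) * ∫ θ in (0 : ℝ)..(2 * π), (c₀ * G θ ^ 2) ^ (2 / β))
      = π * ((c₀ / (2 * π)) * A₀) ^ (2 / β) := by
    intro h
    have e : (2 : ℝ) / β = 1 := by rw [h]; norm_num
    simp only [e, Real.rpow_one]
    rw [intervalIntegral.integral_const_mul, ← hA₀]
    field_simp
  refine ⟨key, fun l hl => ?_, fun h => ⟨keq h, fun l _ => ?_⟩⟩
  · have := mul_le_mul_of_nonneg_left key hl.le
    rw [← mul_assoc l π] at this
    exact sub_le_sub_left (Real.exp_le_exp.2 (neg_le_neg this)) 1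
  · rw [keq h, mul_assoc l π]
end
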